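/- Let A ⊂ X be 1-thin at x ∈ X and let R₀ > 0. Then lim_{r→0} cap₁(A ∩ B(x,r), B(x,R₀)) = 0. -/

import Mathlib

open MeasureTheory Metric Filter Set
open scoped ENNReal NNReal Topology

noncomputable section

namespace MetricBV

variable {X : Type*} [MetricSpace X] [MeasurableSpace X]

/-- A rectifiable curve, encoded as a Lipschitz map on the interval `[0,1]`
(every rectifiable curve admits such a reparametrization). -/
structure Curve (X : Type*) [MetricSpace X] where
  toFun : ℝ → X
  lipschitz : ∃ K : ℝ≥0, LipschitzOnWith K toFun (Set.Icc 0 1)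

/-- The metric speed of a curve at a point. -/
def speed (γ : ℝ → X) (t : ℝ) : ℝ≥0∞ :=
  Filter.limsup (fun h : ℝ => ENNReal.ofReal (dist (γ (t + h)) (γ t) / |h|)) (𝓝[≠] (0 : ℝ))

/-- The curve integral `∫_γ g ds`. -/
def curveIntegral (g : X → ℝ≥0∞) (γ : Curve X) : ℝ≥0∞ :=
  ∫⁻ t in Set.Icc (0 : ℝ) 1, g (γ.toFun t) * speed γ.toFun t

/-- A curve lies in a set `Ω`. -/
def Curve.In (γ : Curve X) (Ω : Set X) : Prop :=
  ∀ t ∈ Set.Icc (0 : ℝ) 1, γ.toFun t ∈ Ω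

/-- The 1-modulus of a family of curves. -/
def Mod1 (μ : Measure X) (Γ : Set (Curve X)) : ℝ≥0∞ :=
  ⨅ (ρ : X → ℝ≥0∞) (_ : Measurable ρ) (_ : ∀ γ ∈ Γ, 1 ≤ curveIntegral ρ γ),
    ∫⁻ x, ρ x ∂μ

/-- `g` is an upper gradient of `u` in `Ω`: the upper gradient inequality holds
along every curve contained in `Ω`. -/
def IsUpperGradientOn (g : X → ℝ≥0∞) (u : X → ℝ) (Ω : Set X) : Prop :=
  ∀ γ : Curve X, γ.In Ω →
    ENNReal.ofReal |u (γ.toFun 1) - u (γ.toFun 0)| ≤ curveIntegral g γ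

/-- `g` is a 1-weak upper gradient of `u` in `Ω`: the upper gradient inequality holds
along every curve in `Ω` outside a family of zero 1-modulus. -/
def IsWeakUpperGradientOn (μ : Measure X) (g : X → ℝ≥0∞) (u : X → ℝ) (Ω : Set X) : Prop :=
  ∃ Γ : Set (Curve X), Mod1 μ Γ = 0 ∧
    ∀ γ : Curve X, γ ∉ Γ → γ.In Ω →
      ENNReal.ofReal |u (γ.toFun 1) - u (γ.toFun 0)| ≤ curveIntegral g γ

/-- Membership in the Newtonian space `N^{1,1}(X)`. -/
def MemN11 (μ : Measure X) (u : X → ℝ) : Prop :=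
  Integrable u μ ∧ ∃ g : X → ℝ≥0∞, Measurable g ∧
    IsWeakUpperGradientOn μ g u Set.univ ∧ ∫⁻ x, g x ∂μ < ⊤

/-- The 1-capacity `cap₁(A) = inf ‖u‖_{N^{1,1}(X)}` over `u ∈ N^{1,1}(X)` with `u ≥ 1` on `A`. -/
def cap1 (μ : Measure X) (A : Set X) : ℝ≥0∞ :=
  ⨅ (u : X → ℝ) (_ : MemN11 μ u) (_ : ∀ x ∈ A, 1 ≤ u x)
    (g : X → ℝ≥0∞) (_ : Measurable g) (_ : IsWeakUpperGradientOn μ g u Set.univ),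
    (∫⁻ x, ENNReal.ofReal |u x| ∂μ + ∫⁻ x, g x ∂μ)

/-- The variational 1-capacity `cap₁(A,Ω) = inf ∫ g_u dμ` over `u ∈ N^{1,1}(X)` with
`u ≥ 1` on `A` and `u = 0` on `X ∖ Ω`. -/
def vcap1 (μ : Measure X) (A Ω : Set X) : ℝ≥0∞ :=
  ⨅ (u : X → ℝ) (_ : MemN11 μ u) (_ : ∀ x ∈ A, 1 ≤ u x) (_ : ∀ x ∈ Ωᶜ, u x = 0)
    (g : X → ℝ≥0∞) (_ : Measurable g) (_ : IsWeakUpperGradientOn μ g u Set.univ),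
    ∫⁻ x, g x ∂μ

/-- Locally Lipschitz in `Ω`: Lipschitz on every compact subset of `Ω`. -/
def LocLipschitzOn (u : X → ℝ) (Ω : Set X) : Prop :=
  ∀ K : Set X, IsCompact K → K ⊆ Ω → ∃ L : ℝ≥0, LipschitzOnWith L u K

/-- Convergence `v i → u` in `L¹_loc(Ω)`. -/
def TendstoL1Loc (μ : Measure X) (v : ℕ → X → ℝ) (u : X → ℝ) (Ω : Set X) : Prop :=
  ∀ K : Set X, IsCompact K → K ⊆ Ω →
    Filter.Tendsto (fun i => ∫⁻ x in K, ENNReal.ofReal |v i x - u x| ∂μ)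
      Filter.atTop (𝓝 0)

/-- The total variation `‖Du‖(Ω)` of `u` in an open set `Ω`: the infimum of
`liminf ∫_Ω g_i dμ` over sequences of locally Lipschitz functions `v i → u` in `L¹_loc(Ω)`
with `g i` a 1-weak upper gradient of `v i` in `Ω`. -/
def tv (μ : Measure X) (u : X → ℝ) (Ω : Set X) : ℝ≥0∞ :=
  ⨅ (v : ℕ → X → ℝ) (_ : ∀ i, LocLipschitzOn (v i) Ω) (_ : TendstoL1Loc μ v u Ω)
    (g : ℕ → X → ℝ≥0∞) (_ : ∀ i, Measurable (g i))
    (_ : ∀ i, IsWeakUpperGradientOn μ (g i) (v i) Ω),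
    Filter.liminf (fun i => ∫⁻ x in Ω, g i x ∂μ) Filter.atTop

/-- The total variation `‖Du‖(A)` for an arbitrary set `A`. -/
def tvs (μ : Measure X) (u : X → ℝ) (A : Set X) : ℝ≥0∞ :=
  ⨅ (U : Set X) (_ : IsOpen U) (_ : A ⊆ U), tv μ u U

/-- The characteristic function of a set, as a real-valued function. -/
def chi (E : Set X) : X → ℝ := Set.indicator E fun _ => (1 : ℝ)

/-- The perimeter `P(E,Ω) = ‖Dχ_E‖(Ω)` of `E` in an open set `Ω`. -/
def perim (μ : Measure X) (E : Set X) (Ω : Set X) : ℝ≥0∞ := tv μ (chi E) Ω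

/-- `u ∈ BV(Ω)`: `u ∈ L¹(Ω)` and `‖Du‖(Ω) < ∞`. -/
def MemBV (μ : Measure X) (u : X → ℝ) (Ω : Set X) : Prop :=
  IntegrableOn u Ω μ ∧ tv μ u Ω < ⊤

/-- `u ∈ BV_loc(Ω)`. -/
def MemBVloc (μ : Measure X) (u : X → ℝ) (Ω : Set X) : Prop :=
  ∀ K : Set X, IsCompact K → K ⊆ Ω → ∃ U : Set X, IsOpen U ∧ K ⊆ U ∧ U ⊆ Ω ∧ MemBV μ u U

/-- `φ ∈ BV_c(Ω)`: a BV function with compact support in `Ω`. -/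
def MemBVc (μ : Measure X) (φ : X → ℝ) (Ω : Set X) : Prop :=
  MemBV μ φ Ω ∧ IsCompact (tsupport φ) ∧ tsupport φ ⊆ Ω

/-- `u` is a 1-minimizer (function of least gradient) in `Ω`. -/
def IsMinimizer (μ : Measure X) (u : X → ℝ) (Ω : Set X) : Prop :=
  MemBVloc μ u Ω ∧ ∀ φ : X → ℝ, MemBVc μ φ Ω →
    tvs μ u (tsupport φ) ≤ tvs μ (fun y => u y + φ y) (tsupport φ)

/-- `u` is a 1-superminimizer in `Ω`. -/
def IsSuperminimizer (μ : Measure X) (u : X → ℝ) (Ω : Set X) : Prop :=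
  MemBVloc μ u Ω ∧ ∀ φ : X → ℝ, MemBVc μ φ Ω → (∀ x, 0 ≤ φ x) →
    tvs μ u (tsupport φ) ≤ tvs μ (fun y => u y + φ y) (tsupport φ)

/-- `u` is a 1-subminimizer in `Ω`. -/
def IsSubminimizer (μ : Measure X) (u : X → ℝ) (Ω : Set X) : Prop :=
  MemBVloc μ u Ω ∧ ∀ φ : X → ℝ, MemBVc μ φ Ω → (∀ x, φ x ≤ 0) →
    tvs μ u (tsupport φ) ≤ tvs μ (fun y => u y + φ y) (tsupport φ)

/-- The lower approximate limit `u^∧(x)`, with values in `[-∞,∞]`. -/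
def lowerApprox (μ : Measure X) (u : X → ℝ) (x : X) : EReal :=
  sSup ((fun t : ℝ => (t : EReal)) '' {t : ℝ | Filter.Tendsto
    (fun r : ℝ => μ ({y | u y < t} ∩ Metric.ball x r) / μ (Metric.ball x r))
    (𝓝[>] (0 : ℝ)) (𝓝 0)})

/-- The upper approximate limit `u^∨(x)`, with values in `[-∞,∞]`. -/
def upperApprox (μ : Measure X) (u : X → ℝ) (x : X) : EReal :=
  sInf ((fun t : ℝ => (t : EReal)) '' {t : ℝ | Filter.Tendsto
    (fun r : ℝ => μ ({y | t < u y} ∩ Metric.ball x r) / μ (Metric.ball x r))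
    (𝓝[>] (0 : ℝ)) (𝓝 0)})

/-- The upper approximate limit of an extended-real-valued function. -/
def upperApproxE (μ : Measure X) (ψ : X → EReal) (x : X) : EReal :=
  sInf ((fun t : ℝ => (t : EReal)) '' {t : ℝ | Filter.Tendsto
    (fun r : ℝ => μ ({y | (t : EReal) < ψ y} ∩ Metric.ball x r) / μ (Metric.ball x r))
    (𝓝[>] (0 : ℝ)) (𝓝 0)})

/-- The measure-theoretic interior `I_E`. -/
def measInterior (μ : Measure X) (E : Set X) : Set X :=
  {x : X | Filter.Tendsto (fun r : ℝ => μ (Metric.ball x r \ E) / μ (Metric.ball x r))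
    (𝓝[>] (0 : ℝ)) (𝓝 0)}

/-- The measure-theoretic boundary `∂*E`. -/
def measBoundary (μ : Measure X) (E : Set X) : Set X :=
  {x : X | 0 < Filter.limsup (fun r : ℝ => μ (Metric.ball x r ∩ E) / μ (Metric.ball x r))
      (𝓝[>] (0 : ℝ)) ∧
    0 < Filter.limsup (fun r : ℝ => μ (Metric.ball x r \ E) / μ (Metric.ball x r))
      (𝓝[>] (0 : ℝ))}

/-- `A` is 1-thin at `x`. -/
def IsThinAt (μ : Measure X) (A : Set X) (x : X) : Prop :=
  Filter.Tendsto (fun r : ℝ =>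
      ENNReal.ofReal r * vcap1 μ (A ∩ Metric.ball x r) (Metric.ball x (2 * r))
        / μ (Metric.ball x r))
    (𝓝[>] (0 : ℝ)) (𝓝 0)

/-- `U` is 1-finely open. -/
def IsFinelyOpen (μ : Measure X) (U : Set X) : Prop :=
  ∀ x ∈ U, IsThinAt μ Uᶜ x

/-- The class `K_{ψ,f}(Ω)` of admissible functions for the obstacle problem. -/
def MemK (μ : Measure X) (ψ : X → EReal) (f : X → ℝ) (Ω : Set X) (u : X → ℝ) : Prop :=
  MemBVloc μ u Set.univ ∧ (∀ᵐ x ∂μ, x ∈ Ω → ψ x ≤ (u x : EReal)) ∧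
    (∀ᵐ x ∂μ, x ∉ Ω → u x = f x)

/-- `u` is a solution of the `K_{ψ,f}(Ω)`-obstacle problem. -/
def IsObstacleSolution (μ : Measure X) (ψ : X → EReal) (f : X → ℝ) (Ω : Set X)
    (u : X → ℝ) : Prop :=
  MemK μ ψ f Ω u ∧ ∀ v : X → ℝ, MemK μ ψ f Ω v → tv μ u Set.univ ≤ tv μ v Set.univ

/-- The standing assumptions: `(X,d,μ)` is a complete metric space with at least two points,
`μ` is a doubling measure with constant `Cd`, and `X` supports a `(1,1)`-Poincaré inequality
with constants `CP`, `lam`. -/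
structure MMS {X : Type*} [MetricSpace X] [MeasurableSpace X] (μ : Measure X)
    (Cd CP lam : ℝ) : Prop where
  complete : CompleteSpace X
  nontrivial : Nontrivial X
  hCd : 1 ≤ Cd
  hCP : 0 < CP
  hlam : 1 ≤ lam
  doubling : ∀ (x : X) (r : ℝ), 0 < r →
    0 < μ (Metric.ball x (2 * r)) ∧
    μ (Metric.ball x (2 * r)) ≤ ENNReal.ofReal Cd * μ (Metric.ball x r) ∧
    μ (Metric.ball x r) < ⊤
  poincare : ∀ (x : X) (r : ℝ), 0 < r → ∀ u : X → ℝ, MeasureTheory.LocallyIntegrable u μ →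
    ∀ g : X → ℝ≥0∞, Measurable g → IsUpperGradientOn g u Set.univ →
      ∫⁻ y in Metric.ball x r, ENNReal.ofReal |u y - ⨍ z in Metric.ball x r, u z ∂μ| ∂μ ≤
        ENNReal.ofReal (CP * r) * (μ (Metric.ball x r) / μ (Metric.ball x (lam * r))) *
          ∫⁻ y in Metric.ball x (lam * r), g y ∂μ

set_option linter.unusedSectionVars false

theorem speed_comp_affine (γ : ℝ → X) (s t : ℝ) {c : ℝ} (hc : 0 < c) :
    speed (fun t => γ (s + t * c)) t = ENNReal.ofReal c * speed γ (s + t * c) := by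
  have hmap : map (fun h : ℝ => h * c) (𝓝[≠] 0) = 𝓝[≠] 0 := by
    have := (Homeomorph.mulRight₀ c hc.ne').isOpenEmbedding.map_nhdsWithin_preimage_eq {0}ᶜ 0
    have hpre : (Homeomorph.mulRight₀ c hc.ne') ⁻¹' {0}ᶜ = {0}ᶜ := by
      ext h
      simp [hc.ne']
    rw [hpre] at this
    simpa using this
  unfold speed
  rw [← ENNReal.limsup_const_mul_of_ne_top ENNReal.ofReal_ne_top]
  conv_rhs => rw [← hmap]
  rw [← Filter.limsup_comp]
  congr 1
  ext h
  simp only [Function.comp]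
  rw [← ENNReal.ofReal_mul hc.le, abs_mul, abs_of_pos hc, add_mul, add_assoc]
  congr 1
  by_cases hh : |h| = 0
  · simp [hh]
  · field_simp

theorem lintegral_eq_mul_lintegral_comp_affine (F : ℝ → ℝ≥0∞) (s : ℝ) {c : ℝ} (hc : 0 < c) :
    ∫⁻ x, F x = ENNReal.ofReal c * ∫⁻ t, F (s + t * c) := by
  rw [← lintegral_add_left_eq_self F s]
  have h := Real.smul_map_volume_mul_right hc.ne'
  conv_lhs => rw [← h]
  rw [lintegral_smul_measure, abs_of_pos hc]
  have := lintegral_map_equiv (μ := volume) (fun x => F (s + x))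
    (Homeomorph.mulRight₀ c hc.ne').toMeasurableEquiv
  simp only [smul_eq_mul]
  congr 1

/-- The restriction of a curve to `[s,t] ⊆ [0,1]`, reparametrized on `[0,1]`. -/
def Curve.sub (γ : Curve X) {s t : ℝ} (hs : 0 ≤ s) (hst : s ≤ t) (ht : t ≤ 1) : Curve X where
  toFun r := γ.toFun (s + r * (t - s))
  lipschitz := by
    obtain ⟨K, hK⟩ := γ.lipschitz
    have h1 : LipschitzOnWith 1 (fun r : ℝ => s + r * (t - s)) (Icc 0 1) := by
      refine LipschitzOnWith.of_dist_le_mul fun a _ b _ => ?_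
      rw [Real.dist_eq, Real.dist_eq, add_sub_add_left_eq_sub, ← sub_mul, abs_mul,
        abs_of_nonneg (sub_nonneg.2 hst), mul_comm]
      gcongr
      simp only [NNReal.coe_one]
      linarith
    refine ⟨K * 1, hK.comp h1 fun r hr => ?_⟩
    constructor
    · nlinarith [hr.1, hr.2]
    · nlinarith [hr.1, hr.2]

theorem curveIntegral_sub (g : X → ℝ≥0∞) (γ : Curve X) {s t : ℝ} (hs : 0 ≤ s) (hst : s < t)
    (ht : t ≤ 1) :
    curveIntegral g (γ.sub hs hst.le ht) =
      ∫⁻ r in Icc s t, g (γ.toFun r) * speed γ.toFun r := by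
  have hc : 0 < t - s := sub_pos.2 hst
  rw [← lintegral_indicator measurableSet_Icc, lintegral_eq_mul_lintegral_comp_affine _ s hc,
    ← lintegral_const_mul' _ _ ENNReal.ofReal_ne_top, curveIntegral,
    ← lintegral_indicator measurableSet_Icc]
  congr 1
  ext r
  have hiff : s + r * (t - s) ∈ Icc s t ↔ r ∈ Icc (0 : ℝ) 1 := by
    constructor
    · rintro ⟨h1, h2⟩
      constructor <;> by_contra! h <;> nlinarith
    · rintro ⟨h1, h2⟩
      constructor <;> nlinarith
  by_cases hr : r ∈ Icc (0 : ℝ) 1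
  · rw [indicator_of_mem hr, indicator_of_mem (hiff.2 hr)]
    have := speed_comp_affine γ.toFun s r hc
    simp only [Curve.sub]
    rw [this]
    ring
  · rw [indicator_of_notMem hr, indicator_of_notMem (fun h => hr (hiff.1 h)), mul_zero]

theorem IsUpperGradientOn.le_setLIntegral {g : X → ℝ≥0∞} {u : X → ℝ}
    (h : IsUpperGradientOn g u univ) (γ : Curve X) {s t : ℝ} (hs : 0 ≤ s) (hst : s ≤ t)
    (ht : t ≤ 1) :
    ENNReal.ofReal |u (γ.toFun t) - u (γ.toFun s)| ≤
      ∫⁻ r in Icc s t, g (γ.toFun r) * speed γ.toFun r := by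
  rcases hst.eq_or_lt with rfl | hst
  · simp
  · have := h (γ.sub hs hst.le ht) fun _ _ => mem_univ _
    rw [curveIntegral_sub g γ hs hst ht] at this
    simpa [Curve.sub] using this

theorem IsUpperGradientOn.continuousOn_comp {g : X → ℝ≥0∞} {u : X → ℝ}
    (h : IsUpperGradientOn g u univ) (γ : Curve X) (hγ : curveIntegral g γ ≠ ∞) :
    ContinuousOn (fun t => u (γ.toFun t)) (Icc 0 1) := by
  rw [Metric.continuousOn_iff]
  intro b hb ε hε
  obtain ⟨δ, hδ, H⟩ := exists_pos_setLIntegral_lt_of_measure_lt hγ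
    (ENNReal.ofReal_pos.2 hε).ne'
  obtain ⟨δ', hδ', hδδ⟩ : ∃ δ' : ℝ, 0 < δ' ∧ ENNReal.ofReal δ' ≤ δ := by
    rcases eq_or_ne δ ∞ with rfl | hd
    · exact ⟨1, one_pos, le_top⟩
    · exact ⟨δ.toReal, ENNReal.toReal_pos hδ.ne' hd, ENNReal.ofReal_toReal_le⟩
  have key : ∀ s ∈ Icc (0 : ℝ) 1, ∀ t ∈ Icc (0 : ℝ) 1, s ≤ t → t - s < δ' →
      |u (γ.toFun t) - u (γ.toFun s)| < ε := by
    intro s hs t ht hst hd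
    have h1 := h.le_setLIntegral γ hs.1 hst ht.2
    have h2 := H (Icc s t) (lt_of_le_of_lt (Measure.restrict_apply_le _ _) (by
      rw [Real.volume_Icc]
      exact lt_of_lt_of_le ((ENNReal.ofReal_lt_ofReal_iff hδ').2 hd) hδδ))
    rw [Measure.restrict_restrict measurableSet_Icc,
      inter_eq_left.2 (Icc_subset_Icc hs.1 ht.2)] at h2
    exact (ENNReal.ofReal_lt_ofReal_iff hε).1 (h1.trans_lt h2)
  refine ⟨δ', hδ', fun a ha hab => ?_⟩
  rw [Real.dist_eq] at hab ⊢
  rcases le_total a b with hle | hle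
  · rw [abs_sub_comm]
    exact key a ha b hb hle (by rw [abs_sub_comm] at hab; exact (le_abs_self _).trans_lt hab)
  · exact key b hb a ha hle ((le_abs_self _).trans_lt hab)

/-- The upper gradient of a nonnegative function may be cut off outside the positivity set,
along curves on which the function is continuous. -/
theorem IsUpperGradientOn.le_curveIntegral_indicator {g : X → ℝ≥0∞} {v : X → ℝ} {S : Set X}
    (h : IsUpperGradientOn g v univ) (hv : ∀ y, 0 ≤ v y) (hS : ∀ y, 0 < v y → y ∈ S)
    (γ : Curve X) (hγ : ContinuousOn (fun t => v (γ.toFun t)) (Icc 0 1)) :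
    ENNReal.ofReal |v (γ.toFun 1) - v (γ.toFun 0)| ≤ curveIntegral (S.indicator g) γ := by
  set F : ℝ → ℝ≥0∞ := fun t => S.indicator g (γ.toFun t) * speed γ.toFun t
  have mono : ∀ J : Set ℝ, J ⊆ Icc 0 1 → MeasurableSet J → (∀ t ∈ J, 0 < v (γ.toFun t)) →
      ∫⁻ r in J, g (γ.toFun r) * speed γ.toFun r ≤ curveIntegral (S.indicator g) γ := by
    intro J hJ hJm hpos
    rw [curveIntegral]
    refine le_trans (le_of_eq ?_) (lintegral_mono_set hJ)
    refine setLIntegral_congr_fun hJm fun t ht => ?_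
    rw [indicator_of_mem (hS _ (hpos t ht))]
  set Z : Set ℝ := Icc 0 1 ∩ (fun t => v (γ.toFun t)) ⁻¹' {0} with hZ
  have hZc : IsCompact Z :=
    isCompact_Icc.of_isClosed_subset
      (hγ.preimage_isClosed_of_isClosed isClosed_Icc isClosed_singleton) inter_subset_left
  have hnz : ∀ t ∈ Icc (0 : ℝ) 1, t ∉ Z → 0 < v (γ.toFun t) := fun t ht htZ =>
    (hv _).lt_of_ne' fun h0 => htZ ⟨ht, h0⟩
  by_cases hne : Z.Nonempty
  · rcases le_total (v (γ.toFun 0)) (v (γ.toFun 1)) with hle | hle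
    · have hm := hZc.sSup_mem hne
      set a := sSup Z
      have h1 := h.le_setLIntegral γ hm.1.1 hm.1.2 le_rfl
      have h0 : v (γ.toFun a) = 0 := hm.2
      rw [h0, sub_zero] at h1
      rw [← setLIntegral_congr Ioc_ae_eq_Icc] at h1
      refine le_trans (ENNReal.ofReal_le_ofReal ?_) (h1.trans (mono _ (fun t ht =>
        ⟨hm.1.1.trans ht.1.le, ht.2⟩) measurableSet_Ioc fun t ht =>
          hnz t ⟨hm.1.1.trans ht.1.le, ht.2⟩ fun htZ => ?_))
      · rw [abs_of_nonneg (sub_nonneg.2 hle), abs_of_nonneg (hv _)]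
        linarith [hv (γ.toFun 0)]
      · exact (not_le.2 ht.1) (le_csSup hZc.bddAbove htZ)
    · have hm := hZc.sInf_mem hne
      set a := sInf Z
      have h1 := h.le_setLIntegral γ le_rfl hm.1.1 hm.1.2
      have h0 : v (γ.toFun a) = 0 := hm.2
      rw [h0, zero_sub, abs_neg] at h1
      rw [← setLIntegral_congr Ico_ae_eq_Icc] at h1
      refine le_trans (ENNReal.ofReal_le_ofReal ?_) (h1.trans (mono _ (fun t ht =>
        ⟨ht.1, ht.2.le.trans hm.1.2⟩) measurableSet_Ico fun t ht =>
          hnz t ⟨ht.1, ht.2.le.trans hm.1.2⟩ fun htZ => ?_))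
      · rw [abs_of_nonpos (sub_nonpos.2 hle), abs_of_nonneg (hv _)]
        linarith [hv (γ.toFun 1)]
      · exact (not_le.2 ht.2) (csInf_le hZc.bddBelow htZ)
  · rw [not_nonempty_iff_eq_empty] at hne
    exact (h γ fun _ _ => mem_univ _).trans (mono _ subset_rfl measurableSet_Icc fun t ht =>
      hnz t ht (by rw [hne]; exact notMem_empty t))

theorem ofReal_dist_le_lintegral_speed (γ : Curve X) :
    ENNReal.ofReal (dist (γ.toFun 1) (γ.toFun 0)) ≤ ∫⁻ t in Icc (0 : ℝ) 1, speed γ.toFun t := by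
  obtain ⟨K, hK⟩ := γ.lipschitz
  set f : ℝ → ℝ := fun t => dist (γ.toFun t) (γ.toFun 0)
  have hf : LipschitzOnWith (1 * K) f (Icc 0 1) :=
    (LipschitzWith.dist_left (γ.toFun 0)).comp_lipschitzOnWith hK
  rw [← uIcc_of_le zero_le_one] at hf
  have hac := hf.absolutelyContinuousOnInterval
  have hint := hac.integral_deriv_eq_sub
  have hle : ∀ t, ENNReal.ofReal |deriv f t| ≤ speed γ.toFun t := by
    intro t
    by_cases hd : DifferentiableAt ℝ f t
    · have h1 := hd.hasDerivAt.tendsto_slope_zero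
      have h2 : Tendsto (fun h : ℝ => ENNReal.ofReal |h⁻¹ • (f (t + h) - f t)|) (𝓝[≠] 0)
          (𝓝 (ENNReal.ofReal |deriv f t|)) :=
        (ENNReal.continuous_ofReal.tendsto _).comp h1.abs
      rw [← h2.limsup_eq]
      refine limsup_le_limsup (Eventually.of_forall fun h => ENNReal.ofReal_le_ofReal ?_)
      rw [smul_eq_mul, abs_mul, abs_inv, div_eq_inv_mul]
      gcongr
      exact abs_dist_sub_le _ _ _
    · simp [deriv_zero_of_not_differentiableAt hd]
  have h0 : f 1 - f 0 = dist (γ.toFun 1) (γ.toFun 0) := by simp [f]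
  rw [← h0, ← hint, intervalIntegral.integral_of_le zero_le_one]
  calc ENNReal.ofReal (∫ t in Ioc (0 : ℝ) 1, deriv f t)
      ≤ ENNReal.ofReal (‖∫ t in Ioc (0 : ℝ) 1, deriv f t‖) :=
        ENNReal.ofReal_le_ofReal (le_abs_self _)
    _ ≤ ∫⁻ t in Ioc (0 : ℝ) 1, ‖deriv f t‖ₑ := by
        rw [ofReal_norm]; exact enorm_integral_le_lintegral_enorm _
    _ ≤ ∫⁻ t in Ioc (0 : ℝ) 1, speed γ.toFun t := by
        refine lintegral_mono fun t => ?_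
        rw [Real.enorm_eq_ofReal_abs]
        exact hle t
    _ ≤ _ := lintegral_mono_set Ioc_subset_Icc_self

theorem isUpperGradientOn_const_of_lipschitz {η : X → ℝ} {L : ℝ≥0} (hη : LipschitzWith L η) :
    IsUpperGradientOn (fun _ => (L : ℝ≥0∞)) η univ := by
  intro γ _
  rw [curveIntegral, lintegral_const_mul' _ _ ENNReal.coe_ne_top]
  refine le_trans ?_ (mul_le_mul_right (ofReal_dist_le_lintegral_speed γ) _)
  rw [← ENNReal.ofReal_coe_nnreal, ← ENNReal.ofReal_mul L.coe_nonneg]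
  exact ENNReal.ofReal_le_ofReal (hη.dist_le_mul _ _)

theorem curveIntegral_mono {g h : X → ℝ≥0∞} (hgh : ∀ y, g y ≤ h y) (γ : Curve X) :
    curveIntegral g γ ≤ curveIntegral h γ :=
  lintegral_mono fun _ => mul_le_mul_left (hgh _) _

theorem curveIntegral_const_mul (g : X → ℝ≥0∞) {c : ℝ≥0∞} (hc : c ≠ ∞) (γ : Curve X) :
    curveIntegral (fun y => c * g y) γ = c * curveIntegral g γ := by
  simp only [curveIntegral, mul_assoc]
  exact lintegral_const_mul' _ _ hc

theorem IsUpperGradientOn.lipschitz_comp {g : X → ℝ≥0∞} {u : X → ℝ} {φ : ℝ → ℝ} {L : ℝ≥0}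
    (h : IsUpperGradientOn g u univ) (hφ : LipschitzWith L φ) :
    IsUpperGradientOn (fun y => L * g y) (fun y => φ (u y)) univ := by
  intro γ hγ
  rw [curveIntegral_const_mul _ ENNReal.coe_ne_top]
  refine le_trans ?_ (mul_le_mul_right (h γ hγ) _)
  rw [← ENNReal.ofReal_coe_nnreal, ← ENNReal.ofReal_mul L.coe_nonneg]
  exact ENNReal.ofReal_le_ofReal (hφ.dist_le_mul _ _)

theorem IsUpperGradientOn.min {g h : X → ℝ≥0∞} {u v : X → ℝ}
    (hu : IsUpperGradientOn g u univ) (hv : IsUpperGradientOn h v univ) :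
    IsUpperGradientOn (fun y => g y + h y) (fun y => min (u y) (v y)) univ := by
  intro γ hγ
  have h1 := (hu γ hγ).trans (curveIntegral_mono (h := fun y => g y + h y) (fun y => le_self_add) γ)
  have h2 := (hv γ hγ).trans (curveIntegral_mono (h := fun y => g y + h y) (fun y => le_add_self) γ)
  refine le_trans (ENNReal.ofReal_le_ofReal (abs_min_sub_min_le_max _ _ _ _)) ?_
  rw [ENNReal.ofReal_max]
  exact max_le h1 h2

/-- Cutting off an upper gradient outside the positivity set, at the expense of an arbitrarily
small multiple of a function whose curve integral controls continuity. -/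
theorem IsUpperGradientOn.indicator_add {g k : X → ℝ≥0∞} {v : X → ℝ} {S : Set X}
    (h : IsUpperGradientOn g v univ) (hv : ∀ y, 0 ≤ v y) (hS : ∀ y, 0 < v y → y ∈ S)
    (hk : ∀ γ : Curve X, curveIntegral k γ ≠ ∞ →
      ContinuousOn (fun t => v (γ.toFun t)) (Icc 0 1)) {δ : ℝ≥0} (hδ : 0 < δ) :
    IsUpperGradientOn (fun y => S.indicator g y + δ * k y) v univ := by
  intro γ hγ
  by_cases hfin : curveIntegral k γ = ∞
  · have : curveIntegral (fun y => S.indicator g y + δ * k y) γ = ∞ := by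
      rw [eq_top_iff]
      refine le_trans (le_of_eq ?_)
        (curveIntegral_mono (g := fun y => δ * k y) (fun y => le_add_self) γ)
      rw [curveIntegral_const_mul _ ENNReal.coe_ne_top, hfin,
        ENNReal.mul_top (by simpa using hδ.ne')]
    rw [this]
    exact le_top
  · exact (h.le_curveIntegral_indicator hv hS γ (hk γ hfin)).trans
      (curveIntegral_mono (fun y => le_self_add) γ)

theorem le_curveIntegral_add (g h : X → ℝ≥0∞) (γ : Curve X) :
    curveIntegral g γ + curveIntegral h γ ≤ curveIntegral (fun y => g y + h y) γ := by
  simp only [curveIntegral, add_mul]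
  exact le_lintegral_add _ _

theorem tsum_curveIntegral_le (ρ : ℕ → X → ℝ≥0∞) (γ : Curve X) :
    ∑' n, curveIntegral (ρ n) γ ≤ curveIntegral (fun y => ∑' n, ρ n y) γ := by
  rw [ENNReal.tsum_eq_iSup_sum]
  refine iSup_le fun s => ?_
  have : ∑ n ∈ s, curveIntegral (ρ n) γ ≤ curveIntegral (fun y => ∑ n ∈ s, ρ n y) γ := by
    classical
    induction s using Finset.induction_on with
    | empty => simp
    | insert a s ha ih =>
      simp only [Finset.sum_insert ha]
      exact le_trans (add_le_add_right ih _) (le_curveIntegral_add _ _ γ)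
  exact this.trans (curveIntegral_mono (fun y => ENNReal.sum_le_tsum s) γ)

/-- A weak upper gradient can be approximated by upper gradients. -/
theorem IsWeakUpperGradientOn.exists_isUpperGradientOn {μ : Measure X} {g : X → ℝ≥0∞}
    {u : X → ℝ} (hg : Measurable g) (h : IsWeakUpperGradientOn μ g u univ) {ε : ℝ≥0∞}
    (hε : ε ≠ 0) :
    ∃ g' : X → ℝ≥0∞, Measurable g' ∧ IsUpperGradientOn g' u univ ∧
      ∫⁻ y, g' y ∂μ ≤ ∫⁻ y, g y ∂μ + ε := by
  obtain ⟨Γ, hΓ, H⟩ := h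
  obtain ⟨e, he, hsum⟩ := ENNReal.exists_pos_sum_of_countable' hε ℕ
  have : ∀ n, ∃ ρ : X → ℝ≥0∞, Measurable ρ ∧ (∀ γ ∈ Γ, 1 ≤ curveIntegral ρ γ) ∧
      ∫⁻ y, ρ y ∂μ < e n := by
    intro n
    have hlt : Mod1 μ Γ < e n := hΓ ▸ he n
    simp only [Mod1, iInf_lt_iff] at hlt
    obtain ⟨ρ, h1, h2, h3⟩ := hlt
    exact ⟨ρ, h1, h2, h3⟩
  choose ρ hρm hρ hρe using this
  refine ⟨fun y => g y + ∑' n, ρ n y, hg.add (Measurable.tsum hρm), ?_, ?_⟩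
  · intro γ hγ
    by_cases hmem : γ ∈ Γ
    · have : curveIntegral (fun y => g y + ∑' n, ρ n y) γ = ∞ := by
        rw [eq_top_iff]
        refine le_trans ?_ ((tsum_curveIntegral_le ρ γ).trans
          (curveIntegral_mono (fun y => le_add_self) γ))
        refine le_trans (le_of_eq ?_) (ENNReal.tsum_le_tsum fun n => hρ n γ hmem)
        simp
      rw [this]
      exact le_top
    · exact (H γ hmem hγ).trans (curveIntegral_mono (fun y => le_self_add) γ)
  · rw [lintegral_add_left hg, lintegral_tsum fun n => (hρm n).aemeasurable]
    gcongr
    exact (ENNReal.tsum_le_tsum fun n => (hρe n).le).trans hsum.le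

theorem IsUpperGradientOn.isWeakUpperGradientOn {μ : Measure X} {g : X → ℝ≥0∞} {u : X → ℝ}
    (h : IsUpperGradientOn g u univ) : IsWeakUpperGradientOn μ g u univ := by
  refine ⟨∅, ?_, fun γ _ hγ => h γ hγ⟩
  rw [← nonpos_iff_eq_zero]
  refine (iInf_le_of_le (fun _ => 0) (iInf_le_of_le measurable_const
    (iInf_le_of_le (by simp) ?_)))
  simp

theorem vcap1_mono {μ : Measure X} {A A' Ω Ω' : Set X} (hA : A ⊆ A') (hΩ : Ω ⊆ Ω') :
    vcap1 μ A Ω' ≤ vcap1 μ A' Ω := by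
  refine le_iInf fun u => le_iInf fun hu => le_iInf fun h1 => le_iInf fun h0 => ?_
  exact iInf_le_of_le u (iInf_le_of_le hu (iInf_le_of_le (fun y hy => h1 y (hA hy))
    (iInf_le_of_le (fun y hy => h0 y fun h => hy (hΩ h)) le_rfl)))

theorem vcap1_le_lintegral {μ : Measure X} {A Ω : Set X} {u : X → ℝ} {g : X → ℝ≥0∞}
    (hu : Integrable u μ) (hg : Measurable g) (hug : IsUpperGradientOn g u univ)
    (h1 : ∀ y ∈ A, 1 ≤ u y) (h0 : ∀ y ∈ Ωᶜ, u y = 0) : vcap1 μ A Ω ≤ ∫⁻ y, g y ∂μ := by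
  rcases eq_or_ne (∫⁻ y, g y ∂μ) ∞ with h | h
  · rw [h]
    exact le_top
  · exact iInf_le_of_le u (iInf_le_of_le
      ⟨hu, g, hg, hug.isWeakUpperGradientOn, lt_top_iff_ne_top.2 h⟩ (iInf_le_of_le h1
        (iInf_le_of_le h0 (iInf_le_of_le g (iInf_le_of_le hg
          (iInf_le_of_le hug.isWeakUpperGradientOn le_rfl))))))

theorem exists_isUpperGradientOn_of_vcap1_lt {μ : Measure X} {A Ω : Set X} {e : ℝ≥0∞}
    (h : vcap1 μ A Ω < e) :
    ∃ (u : X → ℝ) (g : X → ℝ≥0∞), Integrable u μ ∧ Measurable g ∧ IsUpperGradientOn g u univ ∧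
      (∀ y ∈ A, 1 ≤ u y) ∧ (∀ y ∈ Ωᶜ, u y = 0) ∧ ∫⁻ y, g y ∂μ ≤ e := by
  simp only [vcap1, iInf_lt_iff] at h
  obtain ⟨u, hu, h1, h0, g, hg, hug, hlt⟩ := h
  obtain ⟨g', hg', hug', hle⟩ := hug.exists_isUpperGradientOn hg (tsub_pos_of_lt hlt).ne'
  refine ⟨u, g', hu.1, hg', hug', h1, h0, hle.trans (le_of_eq ?_)⟩
  exact add_tsub_cancel_of_le hlt.le

theorem min_measure_le_lintegral_abs_sub [OpensMeasurableSpace X] {μ : Measure X} {u : X → ℝ}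
    (hu : AEMeasurable u μ) (a s t : ℝ) {B : Set X} (hB : MeasurableSet B) :
    ENNReal.ofReal ((t - s) / 2) * min (μ ({y | u y ≤ s} ∩ B)) (μ ({y | t ≤ u y} ∩ B)) ≤
      ∫⁻ y in B, ENNReal.ofReal |u y - a| ∂μ := by
  have hm : AEMeasurable (fun y => ENNReal.ofReal |u y - a|) (μ.restrict B) := by
    have := hu.restrict (s := B)
    fun_prop
  refine le_trans ?_ (mul_meas_ge_le_lintegral₀ hm (ENNReal.ofReal ((t - s) / 2)))
  gcongr
  rw [Measure.restrict_apply' hB]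
  rcases le_total ((s + t) / 2) a with h | h
  · refine (min_le_left _ _).trans (measure_mono (inter_subset_inter_left _ fun y hy => ?_))
    refine ENNReal.ofReal_le_ofReal ?_
    have : u y ≤ s := hy
    rw [abs_sub_comm]
    exact le_trans (by linarith) (le_abs_self _)
  · refine (min_le_right _ _).trans (measure_mono (inter_subset_inter_left _ fun y hy => ?_))
    refine ENNReal.ofReal_le_ofReal ?_
    have : t ≤ u y := hy
    exact le_trans (by linarith) (le_abs_self _)

/-- If passing from `Good j s` to `Good (j + 1) t` never costs more than `K * (E t - E s)`, then
the total drift of the level is controlled by the total increase of `E`. -/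
theorem exists_level_le {Good : ℕ → ℝ → Prop} {E : ℝ → ℝ} (hE : Monotone E) {M K : ℝ}
    (hM : ∀ t, E t ≤ M) (hK : 0 ≤ K)
    (hstep : ∀ j s t, 0 ≤ s → s < t → Good j s → ¬ Good (j + 1) t → t - s ≤ K * (E t - E s))
    (h0 : Good 0 0) (j : ℕ) :
    ∀ δ > 0, ∃ s, 0 ≤ s ∧ Good j s ∧ s ≤ K * (E s - E 0) + δ := by
  induction j with
  | zero => exact fun δ hδ => ⟨0, le_rfl, h0, by simpa using hδ.le⟩
  | succ j ih =>
    intro δ hδ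
    obtain ⟨s, hs0, hs, hle⟩ := ih (δ / 2) (half_pos hδ)
    by_cases hg : Good (j + 1) s
    · exact ⟨s, hs0, hg, by linarith⟩
    set T : Set ℝ := {t | ¬ Good (j + 1) t}
    have hsT : s ∈ T := hg
    have hcost : ∀ t ∈ T, s ≤ t → t - s ≤ K * (E t - E s) := by
      intro t ht hst
      rcases hst.eq_or_lt with rfl | hst
      · simp
      · exact hstep j s t hs0 hst hs ht
    have hbdd : BddAbove T := by
      refine ⟨s + K * (M - E s), fun t ht => ?_⟩
      rcases le_total s t with hst | hst
      · have := mul_le_mul_of_nonneg_left (sub_le_sub_right (hM t) (E s)) hK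
        linarith [hcost t ht hst]
      · have := mul_nonneg hK (sub_nonneg.2 (hM s))
        linarith
    obtain ⟨t, ht, hlt⟩ := exists_lt_of_lt_csSup ⟨s, hsT⟩
      (show sSup T - δ / 4 < sSup T by linarith)
    obtain ⟨t₁, ht₁, hst, hlt₁⟩ : ∃ t₁ ∈ T, s ≤ t₁ ∧ sSup T - δ / 4 < t₁ := by
      rcases le_total s t with h | h
      · exact ⟨t, ht, h, hlt⟩
      · exact ⟨s, hsT, le_rfl, hlt.trans_le h⟩
    refine ⟨t₁ + δ / 4, by linarith, ?_, ?_⟩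
    · by_contra hcon
      have := le_csSup hbdd (show t₁ + δ / 4 ∈ T from hcon)
      linarith
    · have h1 := hcost t₁ ht₁ hst
      have h2 := mul_le_mul_of_nonneg_left (hE (show t₁ ≤ t₁ + δ / 4 by linarith)) hK
      linarith

namespace MMS

variable [BorelSpace X] {μ : Measure X} {Cd CP lam : ℝ}

theorem ball_pos (hX : MMS μ Cd CP lam) (x : X) {r : ℝ} (hr : 0 < r) : 0 < μ (ball x r) := by
  have h := (hX.doubling x (r / 2) (half_pos hr)).1
  rwa [show 2 * (r / 2) = r by ring] at h

theorem ball_lt_top (hX : MMS μ Cd CP lam) (x : X) (r : ℝ) : μ (ball x r) < ∞ := by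
  rcases le_or_gt r 0 with h | h
  · simp [ball_eq_empty.2 h]
  · exact (hX.doubling x r h).2.2

theorem real_ball_pos (hX : MMS μ Cd CP lam) (x : X) {r : ℝ} (hr : 0 < r) :
    0 < μ.real (ball x r) :=
  ENNReal.toReal_pos (hX.ball_pos x hr).ne' (hX.ball_lt_top x r).ne

theorem real_inter_ball_mono (hX : MMS μ Cd CP lam) {x : X} {r : ℝ} {s t : Set X} (h : s ⊆ t)
    (ht : t ⊆ ball x r) : μ.real s ≤ μ.real t :=
  measureReal_mono h (((measure_mono ht).trans_lt (hX.ball_lt_top x r)).ne)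

theorem real_ball_two_mul_le (hX : MMS μ Cd CP lam) (x : X) {r : ℝ} (hr : 0 < r) :
    μ.real (ball x (2 * r)) ≤ Cd * μ.real (ball x r) := by
  have := ENNReal.toReal_mono
    (ENNReal.mul_ne_top ENNReal.ofReal_ne_top (hX.ball_lt_top x r).ne) (hX.doubling x r hr).2.1
  rwa [ENNReal.toReal_mul, ENNReal.toReal_ofReal (zero_le_one.trans hX.hCd)] at this

theorem min_measure_le (hX : MMS μ Cd CP lam) (x : X) {r : ℝ} (hr : 0 < r) {u : X → ℝ}
    (hu : Integrable u μ) {g : X → ℝ≥0∞} (hg : Measurable g) (hug : IsUpperGradientOn g u univ)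
    (s t : ℝ) :
    ENNReal.ofReal ((t - s) / 2) *
        min (μ ({y | u y ≤ s} ∩ ball x r)) (μ ({y | t ≤ u y} ∩ ball x r)) ≤
      ENNReal.ofReal (CP * r) * ∫⁻ y in ball x (lam * r), g y ∂μ := by
  refine (min_measure_le_lintegral_abs_sub hu.aemeasurable _ s t measurableSet_ball).trans
    ((hX.poincare x r hr u hu.locallyIntegrable g hg hug).trans ?_)
  gcongr
  refine (mul_le_mul_right (ENNReal.div_le_of_le_mul (b := 1) ?_) _).trans_eq (mul_one _)
  rw [one_mul]
  exact measure_mono (ball_subset_ball (le_mul_of_one_le_left hr.le hX.hlam))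

/-- The Poincaré inequality for a function truncated between two levels. -/
theorem min_measure_le_truncated (hX : MMS μ Cd CP lam) (x : X) {r : ℝ} (hr : 0 < r)
    {u u' : X → ℝ} (hu : Integrable u μ) (hu' : Measurable u') (huu' : u =ᵐ[μ] u')
    {g : X → ℝ≥0∞} (hg : Measurable g) (hug : IsUpperGradientOn g u univ)
    (hfin : ∫⁻ y, g y ∂μ ≠ ∞) {s t : ℝ} (hs : 0 ≤ s) (hst : s < t) :
    ENNReal.ofReal ((t - s) / 2) *
        min (μ ({y | u y ≤ s} ∩ ball x r)) (μ ({y | t ≤ u y} ∩ ball x r)) ≤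
      ENNReal.ofReal (CP * r) * ∫⁻ y in {y | s < u' y ∧ u' y < t}, g y ∂μ := by
  set N := toMeasurable μ {y | u y ≠ u' y}
  have hN : MeasurableSet N := measurableSet_toMeasurable _ _
  have hN0 : μ N = 0 := by rw [measure_toMeasurable]; exact huu'
  have hNsub : ∀ y, u y ≠ u' y → y ∈ N := fun y hy => subset_toMeasurable μ {y | u y ≠ u' y} hy
  set S₁ : Set X := {y | s < u' y} ∪ N
  set S₂ : Set X := {y | u' y < t} ∪ N
  have hS₁ : MeasurableSet S₁ := (measurableSet_lt measurable_const hu').union hN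
  have hS₂ : MeasurableSet S₂ := (measurableSet_lt hu' measurable_const).union hN
  set φ : ℝ → ℝ := fun a => max 0 (min a t - s)
  have hφ : LipschitzWith 1 φ := by
    refine LipschitzWith.of_dist_le_mul fun a b => ?_
    simp only [NNReal.coe_one, one_mul, Real.dist_eq]
    refine (abs_max_sub_max_le_max _ _ _ _).trans ?_
    rw [sub_self, abs_zero, sub_sub_sub_cancel_right]
    refine max_le (abs_nonneg _) ((abs_min_sub_min_le_max _ _ _ _).trans ?_)
    simp
  have hφ' : LipschitzWith 1 fun a => (t - s) - φ a := by
    simpa using (LipschitzWith.const (t - s)).sub hφ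
  have hφpos : ∀ a, 0 < φ a → s < a := by
    intro a ha
    by_contra! h
    have : φ a = 0 := max_eq_left (by linarith [min_le_left a t])
    linarith
  have hφlt : ∀ a, 0 < t - s - φ a → a < t := by
    intro a ha
    by_contra! h
    have : φ a = t - s := by
      simp only [φ, min_eq_right h]
      exact max_eq_right (by linarith)
    linarith
  have hφnn : ∀ a, 0 ≤ φ a := fun a => le_max_left _ _
  have hφle : ∀ a, φ a ≤ t - s := fun a =>
    max_le (by linarith) (by linarith [min_le_right a t])
  have hcont : ∀ ψ : ℝ → ℝ, LipschitzWith 1 ψ → ∀ γ : Curve X, curveIntegral g γ ≠ ∞ →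
      ContinuousOn (fun a => ψ (u (γ.toFun a))) (Icc 0 1) := fun ψ hψ γ hγ =>
    hψ.continuous.comp_continuousOn (hug.continuousOn_comp γ hγ)
  set v : X → ℝ := fun y => φ (u y)
  have hv : Integrable v μ := by
    refine hu.mono (hφ.continuous.comp_aestronglyMeasurable hu.1) (Eventually.of_forall fun y => ?_)
    rw [Real.norm_eq_abs, Real.norm_eq_abs, abs_of_nonneg (hφnn _)]
    exact max_le (abs_nonneg _) (by linarith [min_le_left (u y) t, le_abs_self (u y)])
  have hle₁ : {y | u y ≤ s} ⊆ {y | v y ≤ 0} := fun y hy => by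
    have : u y ≤ s := hy
    change max 0 (min (u y) t - s) ≤ 0
    exact max_le le_rfl (by linarith [min_le_left (u y) t])
  have hle₂ : {y | t ≤ u y} ⊆ {y | t - s ≤ v y} := fun y hy => by
    have h : t ≤ u y := hy
    change t - s ≤ max 0 (min (u y) t - s)
    rw [min_eq_right h]
    exact le_max_right _ _
  have key : ∀ δ : ℝ≥0, 0 < δ → ENNReal.ofReal ((t - s) / 2) *
        min (μ ({y | u y ≤ s} ∩ ball x r)) (μ ({y | t ≤ u y} ∩ ball x r)) ≤
      ENNReal.ofReal (CP * r) * (∫⁻ y in {y | s < u' y ∧ u' y < t}, g y ∂μ +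
        δ * (2 * ∫⁻ y, g y ∂μ)) := by
    intro δ hδ
    have e₁ : IsUpperGradientOn (fun y => S₁.indicator g y + δ * g y) v univ := by
      refine IsUpperGradientOn.indicator_add ?_ (fun y => hφnn _) (fun y hy => ?_)
        (hcont φ hφ) hδ
      · simpa using hug.lipschitz_comp hφ
      · by_cases h : u y = u' y
        · exact Or.inl (by rw [mem_ofPred_eq, ← h]; exact hφpos _ hy)
        · exact Or.inr (hNsub y h)
    have e₂ : IsUpperGradientOn
        (fun y => S₂.indicator (fun y => S₁.indicator g y + δ * g y) y + δ * g y)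
        (fun y => (t - s) - φ (u y)) univ := by
      refine IsUpperGradientOn.indicator_add ?_ (fun y => sub_nonneg.2 (hφle _)) (fun y hy => ?_)
        (hcont _ hφ') hδ
      · intro γ hγ
        refine le_trans (le_of_eq ?_) (e₁ γ hγ)
        rw [sub_sub_sub_cancel_left, abs_sub_comm]
      · by_cases h : u y = u' y
        · exact Or.inl (by rw [mem_ofPred_eq, ← h]; exact hφlt _ hy)
        · exact Or.inr (hNsub y h)
    have e₃ : IsUpperGradientOn (fun y => (S₁ ∩ S₂).indicator g y + δ * (2 * g y)) v univ := by
      intro γ hγ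
      have := e₂ γ hγ
      rw [sub_sub_sub_cancel_left, abs_sub_comm] at this
      refine this.trans (curveIntegral_mono (fun y => ?_) γ)
      by_cases h2 : y ∈ S₂ <;> by_cases h1 : y ∈ S₁ <;>
        simp only [indicator, h1, h2, mem_inter_iff, and_self, and_false, false_and, if_true,
          if_false, two_mul, mul_add, zero_add, add_assoc, le_refl, le_self_add]
    have hm : Measurable (fun y => (S₁ ∩ S₂).indicator g y + δ * (2 * g y)) :=
      (hg.indicator (hS₁.inter hS₂)).add ((hg.const_mul 2).const_mul _)
    have h := hX.min_measure_le x hr hv hm e₃ 0 (t - s)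
    rw [sub_zero] at h
    refine le_trans ?_ (h.trans ?_)
    · gcongr
    · gcongr
      refine (setLIntegral_le_lintegral _ _).trans ?_
      rw [lintegral_add_left (hg.indicator (hS₁.inter hS₂)),
        lintegral_indicator (hS₁.inter hS₂), lintegral_const_mul' _ _ ENNReal.coe_ne_top,
        lintegral_const_mul' _ _ (by simp)]
      refine add_le_add ?_ le_rfl
      have hsub : S₁ ∩ S₂ ⊆ {y | s < u' y ∧ u' y < t} ∪ N := by
        rintro y ⟨h1 | h1, h2 | h2⟩
        exacts [Or.inl ⟨h1, h2⟩, Or.inr h2, Or.inr h1, Or.inr h1]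
      refine (lintegral_mono_set hsub).trans ((lintegral_union_le _ _ _).trans ?_)
      rw [setLIntegral_measure_zero _ _ hN0, add_zero]
  have hlim : Tendsto (fun n : ℕ => ENNReal.ofReal (CP * r) *
      (∫⁻ y in {y | s < u' y ∧ u' y < t}, g y ∂μ +
        ((1 / ((n : ℝ≥0) + 1) : ℝ≥0) : ℝ≥0∞) * (2 * ∫⁻ y, g y ∂μ))) atTop
      (𝓝 (ENNReal.ofReal (CP * r) * (∫⁻ y in {y | s < u' y ∧ u' y < t}, g y ∂μ +
        ((0 : ℝ≥0) : ℝ≥0∞) * (2 * ∫⁻ y, g y ∂μ)))) := by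
    refine ENNReal.Tendsto.const_mul ?_ (Or.inr ENNReal.ofReal_ne_top)
    refine tendsto_const_nhds.add (ENNReal.Tendsto.mul_const ?_
      (Or.inr (ENNReal.mul_ne_top (by simp) hfin)))
    exact ENNReal.tendsto_coe.2 tendsto_one_div_add_atTop_nhds_zero_nat
  rw [ENNReal.coe_zero, zero_mul, add_zero] at hlim
  exact ge_of_tendsto' hlim fun n => key _ (by positivity)

/-- Spheres are approximately nonempty, as a consequence of connectedness. -/
theorem exists_mem_annulus (hX : MMS μ Cd CP lam) {x z : X} {r : ℝ} (hr : 0 < r)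
    (hz : 4 * r ≤ dist z x) : ∃ y, 3 * r ≤ dist y x ∧ dist y x < 4 * r := by
  by_contra! hcon
  set u : X → ℝ := (ball x (3 * r)).indicator fun _ => 1
  have hu : Integrable u μ :=
    (integrable_indicator_iff measurableSet_ball).2
      (integrableOn_const (hX.ball_lt_top x _).ne)
  have hug : IsUpperGradientOn (fun _ => 0) u univ := by
    intro γ _
    obtain ⟨K, hK⟩ := γ.lipschitz
    have hc : ContinuousOn (fun t => dist (γ.toFun t) x) (uIcc 0 1) := by
      rw [uIcc_of_le zero_le_one]
      exact (continuous_id.dist continuous_const).comp_continuousOn hK.continuousOn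
    have hivt := intermediate_value_uIcc hc
    have hval : u (γ.toFun 1) = u (γ.toFun 0) := by
      have hno : 3 * r ∉ uIcc (dist (γ.toFun 0) x) (dist (γ.toFun 1) x) := by
        intro hmem
        obtain ⟨t, -, ht⟩ := hivt hmem
        have := hcon (γ.toFun t) ht.ge
        simp only at ht
        linarith
      rw [mem_uIcc] at hno
      push Not at hno
      simp only [u, indicator, mem_ball]
      by_cases h1 : dist (γ.toFun 1) x < 3 * r <;> by_cases h0 : dist (γ.toFun 0) x < 3 * r
      · simp [h1, h0]
      · linarith [hno.2 h1.le]
      · linarith [hno.1 h0.le]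
      · simp [h1, h0]
    simp [hval]
  have h := hX.min_measure_le x (r := dist z x + r) (by positivity) hu measurable_const hug 0 1
  simp only [lintegral_zero, mul_zero, nonpos_iff_eq_zero, mul_eq_zero, ENNReal.ofReal_eq_zero]
    at h
  rcases h with h | h
  · norm_num at h
  · refine absurd h (lt_min ?_ ?_).ne'
    · refine (hX.ball_pos z hr).trans_le (measure_mono fun y hy => ⟨?_, ?_⟩)
      · have : y ∉ ball x (3 * r) := by
          rw [mem_ball] at hy ⊢
          linarith [dist_triangle_left z x y]
        simp [u, this]
      · rw [mem_ball] at hy ⊢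
        linarith [dist_triangle y z x]
    · refine (hX.ball_pos x (r := 3 * r) (by positivity)).trans_le
        (measure_mono fun y hy => ⟨?_, ?_⟩)
      · simp [u, hy]
      · rw [mem_ball] at hy ⊢
        linarith

theorem real_ball_le_mul_diff (hX : MMS μ Cd CP lam) {x z : X} {r : ℝ} (hr : 0 < r)
    (hz : 4 * r ≤ dist z x) :
    μ.real (ball x (8 * r)) ≤ Cd ^ 4 * μ.real (ball x (8 * r) \ ball x (2 * r)) := by
  obtain ⟨y, hy3, hy4⟩ := hX.exists_mem_annulus hr hz
  have hC : 0 ≤ Cd := zero_le_one.trans hX.hCd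
  have h1 : μ.real (ball x (8 * r)) ≤ μ.real (ball y (2 * (2 * (2 * (2 * r))))) := by
    refine measureReal_mono (fun w hw => ?_) (hX.ball_lt_top y _).ne
    rw [mem_ball] at hw ⊢
    linarith [dist_triangle_right w y x]
  have h2 : μ.real (ball y r) ≤ μ.real (ball x (8 * r) \ ball x (2 * r)) := by
    refine hX.real_inter_ball_mono (fun w hw => ⟨?_, ?_⟩) sdiff_subset
    · rw [mem_ball] at hw ⊢
      linarith [dist_triangle w y x]
    · rw [mem_ball] at hw ⊢
      linarith [dist_triangle_left y x w]
  have a1 := hX.real_ball_two_mul_le y hr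
  have a2 := hX.real_ball_two_mul_le y (r := 2 * r) (by positivity)
  have a3 := hX.real_ball_two_mul_le y (r := 2 * (2 * r)) (by positivity)
  have a4 := hX.real_ball_two_mul_le y (r := 2 * (2 * (2 * r))) (by positivity)
  calc μ.real (ball x (8 * r)) ≤ Cd * (Cd * (Cd * (Cd * μ.real (ball y r)))) :=
        h1.trans (a4.trans (by gcongr; exact a3.trans (by gcongr; exact a2.trans (by gcongr))))
    _ = Cd ^ 4 * μ.real (ball y r) := by ring
    _ ≤ _ := by gcongr

theorem tendsto_measure_ball_zero (hX : MMS μ Cd CP lam) (x : X) :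
    Tendsto (fun r => μ (ball x r)) (𝓝[>] 0) (𝓝 0) := by
  obtain ⟨z, hz⟩ := @exists_ne X hX.nontrivial x
  have hd : 0 < dist z x := dist_pos.2 hz
  set f : ℝ → ℝ := fun r => μ.real (ball x r)
  have hmono : Monotone f := fun a b hab =>
    measureReal_mono (ball_subset_ball hab) (hX.ball_lt_top x b).ne
  have hlim := hmono.tendsto_nhdsGT 0
  set L := sInf (f '' Ioi 0)
  have hscale : ∀ c : ℝ, 0 < c → Tendsto (fun r => f (c * r)) (𝓝[>] 0) (𝓝 L) := by
    intro c hc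
    refine hlim.comp (tendsto_nhdsWithin_iff.2 ⟨?_, ?_⟩)
    · have : Tendsto (fun r => c * r) (𝓝 0) (𝓝 (c * 0)) := (continuous_const_mul c).tendsto 0
      rw [mul_zero] at this
      exact this.mono_left nhdsWithin_le_nhds
    · filter_upwards [self_mem_nhdsWithin] with r hr
      exact mul_pos hc hr
  have hle : L ≤ Cd ^ 4 * (L - L) := by
    refine le_of_tendsto_of_tendsto (hscale 8 (by norm_num))
      (((hscale 8 (by norm_num)).sub (hscale 2 (by norm_num))).const_mul _) ?_
    filter_upwards [Ioo_mem_nhdsGT (show (0 : ℝ) < dist z x / 4 by positivity)] with r hr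
    refine (hX.real_ball_le_mul_diff hr.1 (by linarith [hr.2])).trans_eq ?_
    rw [measureReal_sdiff (ball_subset_ball (by linarith [hr.1])) measurableSet_ball
      (hX.ball_lt_top x _).ne]
  have hL : L = 0 := by
    refine le_antisymm (by simpa using hle) (Real.sInf_nonneg ?_)
    rintro _ ⟨r, -, rfl⟩
    exact measureReal_nonneg
  rw [hL] at hlim
  have := ENNReal.tendsto_ofReal hlim
  rw [ENNReal.ofReal_zero] at this
  refine this.congr fun r => ?_
  exact ENNReal.ofReal_toReal (hX.ball_lt_top x r).ne

theorem mul_real_ball_le_of_tower (hX : MMS μ Cd CP lam) (x : X) {R : ℝ} (hR : 0 < R)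
    {u : X → ℝ} (hu : Integrable u μ) {g : X → ℝ≥0∞} (hg : Measurable g)
    (hug : IsUpperGradientOn g u univ) (hfin : ∫⁻ y, g y ∂μ ≠ ∞) {c Λ : ℝ} (hc : 0 < c)
    (hcC : 2 * Cd * c ≤ 1) (hΛ : ∀ j : ℕ, R / 2 ^ j ≤ Λ * μ.real (ball x (R / 2 ^ j)))
    (h0 : c * μ.real (ball x R) ≤ μ.real ({y | u y ≤ 0} ∩ ball x R))
    (hsmall : 2 * CP * Λ / c * (∫⁻ y, g y ∂μ).toReal ≤ 1 / 8) (j : ℕ) :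
    c * μ.real (ball x (R / 2 ^ j)) ≤ μ.real ({y | u y ≤ 1 / 4} ∩ ball x (R / 2 ^ j)) := by
  set u' := hu.aemeasurable.mk u
  have hu' : Measurable u' := hu.aemeasurable.measurable_mk
  have hCd := hX.hCd
  have hCP := hX.hCP
  have hr : ∀ j : ℕ, 0 < R / 2 ^ j := fun j => by positivity
  have hΛ0 : 0 ≤ Λ := by
    by_contra! h
    have h1 := mul_neg_of_neg_of_pos h (hX.real_ball_pos x (hr 0))
    linarith [hΛ 0, hr 0]
  have hI : ∀ t, ∫⁻ y in {y | u' y < t}, g y ∂μ ≠ ∞ := fun t =>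
    ne_top_of_le_ne_top hfin (setLIntegral_le_lintegral _ _)
  set E : ℝ → ℝ := fun t => (∫⁻ y in {y | u' y < t}, g y ∂μ).toReal
  have hM : ∀ t, E t ≤ (∫⁻ y, g y ∂μ).toReal := fun t =>
    ENNReal.toReal_mono hfin (setLIntegral_le_lintegral _ _)
  have hE : Monotone E := fun s t hst =>
    ENNReal.toReal_mono (hI t) (lintegral_mono_set fun y hy => lt_of_lt_of_le hy hst)
  have hE0 : 0 ≤ E 0 := ENNReal.toReal_nonneg
  have hlevel : ∀ s t, s < t →
      ∫⁻ y in {y | s < u' y ∧ u' y < t}, g y ∂μ ≤ ENNReal.ofReal (E t - E s) := by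
    intro s t hst
    have hm : MeasurableSet {y | s < u' y ∧ u' y < t} :=
      (measurableSet_lt measurable_const hu').inter (measurableSet_lt hu' measurable_const)
    rw [ENNReal.ofReal_sub _ ENNReal.toReal_nonneg, ENNReal.ofReal_toReal (hI t),
      ENNReal.ofReal_toReal (hI s)]
    refine ENNReal.le_sub_of_add_le_left (hI s) ?_
    have hd : Disjoint {y | u' y < s} {y | s < u' y ∧ u' y < t} :=
      disjoint_left.2 fun y h1 h2 => lt_asymm h2.1 h1
    have hsub : {y | u' y < s} ∪ {y | s < u' y ∧ u' y < t} ⊆ {y | u' y < t} :=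
      union_subset (fun y h => lt_trans h hst) fun y h => h.2
    rw [← lintegral_union hm hd]
    exact lintegral_mono_set hsub
  set K := 2 * CP * Λ / c
  have hK : 0 ≤ K := by positivity
  set Good : ℕ → ℝ → Prop := fun j s => c * μ.real (ball x (R / 2 ^ j)) ≤
    μ.real ({y | u y ≤ s} ∩ ball x (R / 2 ^ j))
  have hstep : ∀ j s t, 0 ≤ s → s < t → Good j s → ¬ Good (j + 1) t → t - s ≤ K * (E t - E s) := by
    intro j s t hs0 hst hs ht
    simp only [Good, not_le] at hs ht
    set r := R / 2 ^ j
    set b := μ.real (ball x r)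
    set b' := μ.real (ball x (R / 2 ^ (j + 1)))
    have hb : 0 < b := hX.real_ball_pos x (hr j)
    have hr2 : r = 2 * (R / 2 ^ (j + 1)) := by
      simp only [r, pow_succ]
      field_simp
    have hbb' : b ≤ Cd * b' := by
      have := hX.real_ball_two_mul_le x (hr (j + 1))
      rwa [← hr2] at this
    have hb' : 0 < b' := hX.real_ball_pos x (hr (j + 1))
    have ht' : c * b ≤ μ.real ({y | t ≤ u y} ∩ ball x r) := by
      have h1 : b' ≤ μ.real ({y | u y ≤ t} ∩ ball x (R / 2 ^ (j + 1))) +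
          μ.real ({y | t ≤ u y} ∩ ball x r) := by
        refine (measureReal_mono (fun y hy => ?_) ?_).trans (measureReal_union_le _ _)
        · rcases le_total (u y) t with h | h
          · exact Or.inl ⟨h, hy⟩
          · exact Or.inr ⟨h, ball_subset_ball (by linarith [hr (j + 1)]) hy⟩
        · exact (measure_union_lt_top
            ((measure_mono inter_subset_right).trans_lt (hX.ball_lt_top x _))
            ((measure_mono inter_subset_right).trans_lt (hX.ball_lt_top x _))).ne
      nlinarith
    have hmin : ENNReal.ofReal (c * b) ≤
        min (μ ({y | u y ≤ s} ∩ ball x r)) (μ ({y | t ≤ u y} ∩ ball x r)) :=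
      le_min (ENNReal.ofReal_le_of_le_toReal hs) (ENNReal.ofReal_le_of_le_toReal ht')
    have hP := (hX.min_measure_le_truncated x (hr j) hu hu' hu.aemeasurable.ae_eq_mk hg hug hfin
      hs0 hst).trans (mul_le_mul_right (hlevel s t hst) _)
    have hP' := (mul_le_mul_right hmin _).trans hP
    have hΔ : 0 ≤ E t - E s := sub_nonneg.2 (hE hst.le)
    have hrj := hr j
    rw [← ENNReal.ofReal_mul (by linarith), ← ENNReal.ofReal_mul (by positivity),
      ENNReal.ofReal_le_ofReal_iff (by positivity)] at hP'
    have h2 : CP * r * (E t - E s) ≤ CP * (Λ * b) * (E t - E s) := by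
      gcongr
      exact hΛ j
    have h3 : (t - s) * c * b ≤ 2 * CP * Λ * (E t - E s) * b := by linarith
    have h4 := le_of_mul_le_mul_right h3 hb
    rw [← le_div_iff₀ hc] at h4
    exact h4.trans_eq (by simp only [K]; ring)
  obtain ⟨s, -, hs, hle⟩ := exists_level_le hE hM hK hstep (by simpa [Good] using h0) j (1 / 8)
    (by norm_num)
  have hle' : s ≤ 1 / 4 := by
    have := mul_le_mul_of_nonneg_left
      (show E s - E 0 ≤ (∫⁻ y, g y ∂μ).toReal by linarith [hM s]) hK
    linarith
  exact hs.trans (hX.real_inter_ball_mono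
    (inter_subset_inter_left _ fun y hy => le_trans hy hle') inter_subset_right)

theorem vcap1_le_of_quarter (hX : MMS μ Cd CP lam) {x : X} {A : Set X} {ρ R₀ : ℝ} (hρ : 0 < ρ)
    (hρR : ρ ≤ R₀) {u : X → ℝ} (hu : Integrable u μ) {g : X → ℝ≥0∞} (hg : Measurable g)
    (hug : IsUpperGradientOn g u univ) {c : ℝ} (hc : 0 < c) (hc1 : c ≤ 1)
    (hA : ∀ y ∈ A ∩ ball x (ρ / 2), 1 ≤ u y)
    (hq : c * μ.real (ball x ρ) ≤ μ.real ({y | u y ≤ 1 / 4} ∩ ball x ρ)) {δ : ℝ≥0} (hδ : 0 < δ) :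
    vcap1 μ (A ∩ ball x (ρ / 2)) (ball x R₀) ≤
      (2 + ENNReal.ofReal (16 * CP / c)) * ∫⁻ y in ball x (lam * ρ), g y ∂μ +
        δ * ∫⁻ y, g y ∂μ := by
  have hCP := hX.hCP
  set φ : ℝ → ℝ := fun a => max 0 (2 * a - 1)
  set ψ : ℝ → ℝ := fun a => max 0 (min 1 (2 - 2 / ρ * a))
  set κ : ℝ≥0 := Real.toNNReal (2 / ρ)
  have hκ : (κ : ℝ) = 2 / ρ := Real.coe_toNNReal _ (by positivity)
  have hφ : LipschitzWith 2 φ := by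
    refine LipschitzWith.of_dist_le_mul fun a b => ?_
    rw [Real.dist_eq, Real.dist_eq]
    refine (abs_max_sub_max_le_max _ _ _ _).trans ?_
    rw [sub_self, abs_zero, sub_sub_sub_cancel_right, ← mul_sub, abs_mul]
    exact max_le (by positivity) (by simp)
  have hψ : LipschitzWith κ ψ := by
    refine LipschitzWith.of_dist_le_mul fun a b => ?_
    rw [Real.dist_eq, Real.dist_eq, hκ]
    refine (abs_max_sub_max_le_max _ _ _ _).trans ?_
    rw [sub_self, abs_zero]
    refine max_le (by positivity) ((abs_min_sub_min_le_max _ _ _ _).trans ?_)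
    rw [sub_self, abs_zero, sub_sub_sub_cancel_left, ← mul_sub, abs_mul, abs_sub_comm b a,
      abs_of_pos (show 0 < 2 / ρ by positivity)]
    exact max_le (by positivity) le_rfl
  set η : X → ℝ := fun y => ψ (dist y x)
  have hη : LipschitzWith κ η := by
    have := hψ.comp (LipschitzWith.dist_left x)
    rwa [mul_one] at this
  set v : X → ℝ := fun y => min (φ (u y)) (η y)
  have hv0 : ∀ y, 0 ≤ v y := fun y => le_min (le_max_left _ _) (le_max_left _ _)
  have hvpos : ∀ y, 0 < v y → y ∈ {y | 1 / 2 ≤ u y} ∩ ball x ρ := by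
    intro y hy
    obtain ⟨h1, h2⟩ := lt_min_iff.1 hy
    rcases lt_max_iff.1 h1 with h1 | h1
    · exact absurd h1 (lt_irrefl _)
    rcases lt_max_iff.1 h2 with h2 | h2
    · exact absurd h2 (lt_irrefl _)
    refine ⟨show 1 / 2 ≤ u y by linarith, ?_⟩
    have h3 := (lt_min_iff.1 h2).2
    have h4 : dist y x * (2 / ρ) < ρ * (2 / ρ) := by
      rw [mul_div_cancel₀ 2 hρ.ne']
      linarith
    exact lt_of_mul_lt_mul_right h4 (by positivity)
  set S := toMeasurable μ ({y | 1 / 2 ≤ u y} ∩ ball x ρ) ∩ ball x ρ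
  have hSm : MeasurableSet S := (measurableSet_toMeasurable _ _).inter measurableSet_ball
  have hμS : μ S ≤ μ ({y | 1 / 2 ≤ u y} ∩ ball x ρ) :=
    (measure_mono inter_subset_left).trans_eq (measure_toMeasurable _)
  have hvS : ∀ y, 0 < v y → y ∈ S := fun y hy =>
    ⟨subset_toMeasurable μ _ (hvpos y hy), (hvpos y hy).2⟩
  have hv : Integrable v μ := by
    refine (hu.const_mul 2).mono ((hφ.continuous.comp_aestronglyMeasurable hu.1).inf
      hη.continuous.measurable.aestronglyMeasurable) (Eventually.of_forall fun y => ?_)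
    rw [Real.norm_eq_abs, Real.norm_eq_abs, abs_of_nonneg (hv0 y)]
    refine (min_le_left _ _).trans (max_le (abs_nonneg _) ?_)
    linarith [le_abs_self (2 * u y)]
  have hvg : IsUpperGradientOn (fun y => S.indicator (fun y => (2 : ℝ≥0) * g y + κ) y + δ * g y)
      v univ := by
    refine IsUpperGradientOn.indicator_add ((hug.lipschitz_comp hφ).min
      (isUpperGradientOn_const_of_lipschitz hη)) hv0 hvS (fun γ hγ => ?_) hδ
    obtain ⟨L, hL⟩ := γ.lipschitz
    exact (hφ.continuous.comp_continuousOn (hug.continuousOn_comp γ hγ)).inf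
      (hη.continuous.comp_continuousOn hL.continuousOn)
  have hm : Measurable fun y => (2 : ℝ≥0) * g y + κ := (hg.const_mul _).add_const _
  have hm' : Measurable fun y => S.indicator (fun y => (2 : ℝ≥0) * g y + κ) y + δ * g y :=
    (hm.indicator hSm).add (hg.const_mul _)
  refine (vcap1_le_lintegral hv hm' hvg ?_ ?_).trans ?_
  · rintro y ⟨hyA, hy⟩
    have hy' : dist y x < ρ / 2 := hy
    refine le_min (le_max_of_le_right ?_) (le_max_of_le_right (le_min le_rfl ?_))
    · linarith [hA y ⟨hyA, hy⟩]
    · have : 2 / ρ * dist y x ≤ 2 / ρ * (ρ / 2) := by gcongr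
      rw [show 2 / ρ * (ρ / 2) = 1 by field_simp] at this
      linarith
  · intro y hy
    refine le_antisymm (not_lt.1 fun h => hy ?_) (hv0 y)
    exact ball_subset_ball hρR (hvpos y h).2
  · rw [lintegral_add_left (hm.indicator hSm), lintegral_indicator hSm,
      lintegral_const_mul' _ _ ENNReal.coe_ne_top, lintegral_add_right _ measurable_const,
      lintegral_const_mul' _ _ ENNReal.coe_ne_top, setLIntegral_const, add_mul]
    refine add_le_add (add_le_add ?_ ?_) le_rfl
    · refine mul_le_mul_right (lintegral_mono_set fun y hy => ?_) _
      exact ball_subset_ball (le_mul_of_one_le_left hρ.le hX.hlam) hy.2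
    · set ν := μ ({y | 1 / 2 ≤ u y} ∩ ball x ρ)
      have hmin : ENNReal.ofReal c * ν ≤ min (μ ({y | u y ≤ 1 / 4} ∩ ball x ρ)) ν := by
        refine le_min ?_ (mul_le_of_le_one_left zero_le (ENNReal.ofReal_le_one.2 hc1))
        calc ENNReal.ofReal c * ν ≤ ENNReal.ofReal c * μ (ball x ρ) := by
              exact mul_le_mul_right (measure_mono inter_subset_right) _
          _ = ENNReal.ofReal (c * μ.real (ball x ρ)) := by
              rw [ENNReal.ofReal_mul hc.le]
              congr 1
              exact (ENNReal.ofReal_toReal (hX.ball_lt_top x ρ).ne).symm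
          _ ≤ _ := ENNReal.ofReal_le_of_le_toReal hq
      have hP := hX.min_measure_le x hρ hu hg hug (1 / 4) (1 / 2)
      have hP' := mul_le_mul_right ((mul_le_mul_right hmin _).trans hP)
        (ENNReal.ofReal (16 / (c * ρ)))
      rw [← mul_assoc, ← mul_assoc, ← mul_assoc, ← ENNReal.ofReal_mul (by positivity),
        ← ENNReal.ofReal_mul (by positivity), ← ENNReal.ofReal_mul (by positivity)] at hP'
      have e1 : 16 / (c * ρ) * ((1 / 2 - 1 / 4) / 2) * c = 2 / ρ := by
        field_simp
        norm_num
      have e2 : 16 / (c * ρ) * (CP * ρ) = 16 * CP / c := by field_simp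
      rw [e1, e2] at hP'
      exact (mul_le_mul_right hμS _).trans hP'

theorem eventually_vcap1_lt (hX : MMS μ Cd CP lam) {A : Set X} {x : X} (hA : IsThinAt μ A x)
    {e : ℝ} (he : 0 < e) :
    ∀ᶠ r in 𝓝[>] (0 : ℝ), vcap1 μ (A ∩ ball x r) (ball x (2 * r)) <
      ENNReal.ofReal (e * (μ.real (ball x r) / r)) := by
  filter_upwards [hA.eventually_lt_const (ENNReal.ofReal_pos.2 he), self_mem_nhdsWithin]
    with r hlt hr
  rw [mem_Ioi] at hr
  have hr' : ENNReal.ofReal r ≠ 0 := (ENNReal.ofReal_pos.2 hr).ne'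
  rw [ENNReal.div_lt_iff (Or.inl (hX.ball_pos x hr).ne') (Or.inl (hX.ball_lt_top x r).ne),
    mul_comm, ← ENNReal.lt_div_iff_mul_lt (Or.inl hr') (Or.inl ENNReal.ofReal_ne_top)] at hlt
  rwa [← mul_div_assoc, ENNReal.ofReal_div_of_pos hr, ENNReal.ofReal_mul he.le, Measure.real,
    ENNReal.ofReal_toReal (hX.ball_lt_top x r).ne]

/-- At a radius minimizing `μ(B(x,r))/r` among its dyadic descendants, a function almost realizing
the capacity of a thin set can be localized to arbitrarily small balls. -/
theorem exists_vcap1_le_of_density_le (hX : MMS μ Cd CP lam) {A : Set X} {x z : X} {r R₀ : ℝ}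
    (hr : 0 < r) (hz : 4 * r ≤ dist z x) (hR₀ : 0 < R₀)
    (hmin : ∀ k : ℕ, μ.real (ball x r) / r ≤ μ.real (ball x (r / 2 ^ k)) / (r / 2 ^ k))
    (hcap : vcap1 μ (A ∩ ball x r) (ball x (2 * r)) <
      ENNReal.ofReal (1 / (256 * CP * Cd ^ 4) * (μ.real (ball x r) / r)))
    {ε : ℝ≥0∞} (hε : ε ≠ 0) : ∃ s > 0, vcap1 μ (A ∩ ball x s) (ball x R₀) ≤ ε := by
  have hCd := hX.hCd
  have hCP := hX.hCP
  obtain ⟨u, g, hu, hg, hug, h1, h0, hle⟩ := exists_isUpperGradientOn_of_vcap1_lt hcap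
  have hfin : ∫⁻ y, g y ∂μ ≠ ∞ := ne_top_of_le_ne_top ENNReal.ofReal_ne_top hle
  set c : ℝ := 1 / (2 * Cd ^ 4)
  have hc : 0 < c := by positivity
  have hpow : Cd ≤ Cd ^ 4 := le_self_pow₀ hCd (by norm_num)
  have hcC : 2 * Cd * c ≤ 1 := by
    rw [mul_one_div, div_le_one (by positivity)]
    linarith
  have hm := hX.real_ball_pos x hr
  have hF : 0 < μ.real (ball x r) / r := div_pos hm hr
  have htower := hX.mul_real_ball_le_of_tower x (R := 8 * r) (by positivity) hu hg hug hfin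
    (Λ := 8 / (μ.real (ball x r) / r)) hc hcC ?_ ?_ ?_
  · obtain ⟨δ, hδ, hδε⟩ : ∃ δ : ℝ≥0, 0 < δ ∧ δ * ∫⁻ y, g y ∂μ ≤ ε / 2 := by
      obtain ⟨δ, hδ, h⟩ := ENNReal.exists_nnreal_pos_mul_lt hfin (ENNReal.half_pos hε).ne'
      exact ⟨δ, hδ, h.le⟩
    have hρ : Tendsto (fun j : ℕ => 8 * r / 2 ^ j) atTop (𝓝[>] 0) := by
      refine tendsto_nhdsWithin_iff.2 ⟨?_, Eventually.of_forall fun j => by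
        rw [mem_Ioi]; positivity⟩
      exact tendsto_const_nhds.div_atTop (tendsto_pow_atTop_atTop_of_one_lt one_lt_two)
    have hlam : Tendsto (fun a : ℝ => lam * a) (𝓝[>] 0) (𝓝[>] 0) := by
      refine tendsto_nhdsWithin_iff.2 ⟨?_, ?_⟩
      · have : Tendsto (fun a => lam * a) (𝓝 0) (𝓝 (lam * 0)) :=
          (continuous_const_mul lam).tendsto 0
        rw [mul_zero] at this
        exact this.mono_left nhdsWithin_le_nhds
      · filter_upwards [self_mem_nhdsWithin] with a ha
        exact mul_pos (zero_lt_one.trans_le hX.hlam) ha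
    have hint := ENNReal.Tendsto.const_mul (a := 2 + ENNReal.ofReal (16 * CP / c))
      (tendsto_setLIntegral_zero hfin ((hX.tendsto_measure_ball_zero x).comp (hlam.comp hρ)))
      (Or.inr (by simp))
    rw [mul_zero] at hint
    obtain ⟨j, hj, hj'⟩ := ((hint.eventually_le_const (ENNReal.half_pos hε)).and
      (hρ.eventually (Ioo_mem_nhdsGT (lt_min hR₀ hr)))).exists
    set ρ := 8 * r / 2 ^ j
    refine ⟨ρ / 2, half_pos hj'.1, ?_⟩
    refine (hX.vcap1_le_of_quarter hj'.1 (hj'.2.le.trans (min_le_left _ _)) hu hg hug hc ?_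
      (fun y hy => h1 y ⟨hy.1, ?_⟩) (htower j) hδ).trans ?_
    · nlinarith
    · refine ball_subset_ball ?_ hy.2
      linarith [hj'.1, hj'.2.trans_le (min_le_right _ _)]
    · exact (add_le_add hj hδε).trans_eq (ENNReal.add_halves ε)
  · intro j
    rcases le_or_gt j 3 with hj | hj
    · have h2 : (2 : ℝ) ^ j ≤ 2 ^ 3 := pow_le_pow_right₀ one_le_two hj
      have h3 : r ≤ 8 * r / 2 ^ j := by
        rw [le_div_iff₀ (by positivity)]
        nlinarith
      calc 8 * r / 2 ^ j ≤ 8 * r := div_le_self (by positivity) (one_le_pow₀ one_le_two)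
        _ = 8 / (μ.real (ball x r) / r) * μ.real (ball x r) := by field_simp
        _ ≤ _ := by
          gcongr
          exact (hX.ball_lt_top x _).ne
    · obtain ⟨k, rfl⟩ := Nat.exists_eq_add_of_le hj.le
      have hk : 8 * r / 2 ^ (3 + k) = r / 2 ^ k := by
        rw [pow_add]
        field_simp
        norm_num
      have hq : 0 < r / 2 ^ k := by positivity
      rw [hk, div_mul_eq_mul_div, le_div_iff₀ hF]
      have := (le_div_iff₀ hq).1 (hmin k)
      nlinarith [hX.real_ball_pos x hq]
  · have hsub : ball x (8 * r) \ ball x (2 * r) ⊆ {y | u y ≤ 0} ∩ ball x (8 * r) :=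
      fun y hy => ⟨(h0 y hy.2).le, hy.1⟩
    refine le_trans ?_ (hX.real_inter_ball_mono hsub inter_subset_right)
    have hann := hX.real_ball_le_mul_diff hr hz
    have hd : 0 ≤ μ.real (ball x (8 * r) \ ball x (2 * r)) := measureReal_nonneg
    rw [one_div_mul_eq_div, div_le_iff₀ (by positivity)]
    nlinarith [mul_nonneg hd (show 0 ≤ Cd ^ 4 by positivity)]
  · have := ENNReal.toReal_le_of_le_ofReal (by positivity) hle
    refine (mul_le_mul_of_nonneg_left this (by positivity)).trans_eq ?_
    simp only [c]
    field_simp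
    norm_num

theorem exists_vcap1_le (hX : MMS μ Cd CP lam) {A : Set X} {x : X} (hA : IsThinAt μ A x) {R₀ : ℝ}
    (hR₀ : 0 < R₀) {ε : ℝ≥0∞} (hε : ε ≠ 0) :
    ∃ s > 0, vcap1 μ (A ∩ ball x s) (ball x R₀) ≤ ε := by
  have hCd := hX.hCd
  have hCP := hX.hCP
  by_cases h : ∃ M, ∃ᶠ r in 𝓝[>] (0 : ℝ), μ.real (ball x r) / r ≤ M
  · obtain ⟨M, hM⟩ := h
    obtain ⟨ε', hε', hlt⟩ := ENNReal.lt_iff_exists_nnreal_btwn.1 (pos_iff_ne_zero.2 hε)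
    have hε'0 : (0 : ℝ) < ε' := by exact_mod_cast hε'
    have hM0 : 0 < max M 1 := lt_max_of_lt_right one_pos
    obtain ⟨r, hr, hcap, hr0, hrR⟩ := (hM.and_eventually
      ((hX.eventually_vcap1_lt hA (div_pos hε'0 hM0)).and
        (Ioo_mem_nhdsGT (half_pos hR₀)))).exists
    refine ⟨r, hr0, (vcap1_mono le_rfl (ball_subset_ball (by linarith))).trans
      (hcap.le.trans (le_trans ?_ hlt.le))⟩
    rw [← ENNReal.ofReal_coe_nnreal]
    refine ENNReal.ofReal_le_ofReal ?_
    rw [div_mul_eq_mul_div, div_le_iff₀ hM0]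
    gcongr
    exact hr.trans (le_max_left _ _)
  · push Not at h
    obtain ⟨z, hz⟩ := @exists_ne X hX.nontrivial x
    have hev := (hX.eventually_vcap1_lt hA (show 0 < 1 / (256 * CP * Cd ^ 4) by positivity)).and
      (Ioo_mem_nhdsGT (show (0 : ℝ) < dist z x / 4 from div_pos (dist_pos.2 hz) (by norm_num)))
    obtain ⟨r₀, hr₀, hsub⟩ := mem_nhdsGT_iff_exists_Ioc_subset.1 hev
    rw [mem_Ioi] at hr₀
    have hseq : Tendsto (fun l : ℕ => r₀ / 2 ^ l) atTop (𝓝[>] 0) := by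
      refine tendsto_nhdsWithin_iff.2 ⟨?_, Eventually.of_forall fun j => by
        rw [mem_Ioi]; positivity⟩
      exact tendsto_const_nhds.div_atTop (tendsto_pow_atTop_atTop_of_one_lt one_lt_two)
    have hF : Tendsto (fun l : ℕ => μ.real (ball x (r₀ / 2 ^ l)) / (r₀ / 2 ^ l)) cofinite
        atTop := by
      rw [Nat.cofinite_eq_atTop]
      exact (tendsto_atTop.2 fun M => (h M).mono fun r hr => hr.le : Tendsto
        (fun r => μ.real (ball x r) / r) (𝓝[>] 0) atTop).comp hseq
    obtain ⟨l, hl⟩ := hF.exists_forall_le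
    have hmem : r₀ / 2 ^ l ∈ Ioc 0 r₀ :=
      ⟨by positivity, div_le_self hr₀.le (one_le_pow₀ one_le_two)⟩
    obtain ⟨hcap, hr0, hrz⟩ := hsub hmem
    refine hX.exists_vcap1_le_of_density_le hr0 ((lt_div_iff₀' four_pos).1 hrz).le hR₀ (fun k => ?_)
      hcap hε
    rw [div_div, ← pow_add]
    exact hl (l + k)

end MMS

/-- If `A` is 1-thin at `x` and `R₀ > 0`, then `cap₁(A ∩ B(x,r), B(x,R₀)) → 0` as `r → 0`. -/
theorem capacity_tendsto_zero_at_thinness_points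
    {X : Type*} [MetricSpace X] [MeasurableSpace X] [BorelSpace X]
    (μ : Measure X) (Cd CP lam : ℝ) (hX : MMS μ Cd CP lam)
    (A : Set X) (x : X) (hthin : IsThinAt μ A x) (R₀ : ℝ) (hR₀ : 0 < R₀) :
    Filter.Tendsto (fun r : ℝ => vcap1 μ (A ∩ Metric.ball x r) (Metric.ball x R₀))
      (𝓝[>] (0 : ℝ)) (𝓝 0) := by
  refine ENNReal.tendsto_nhds_zero.2 fun ε hε => ?_
  obtain ⟨s, hs, hle⟩ := hX.exists_vcap1_le hthin hR₀ hε.ne'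
  filter_upwards [Ioo_mem_nhdsGT hs] with r hr
  exact (vcap1_mono (inter_subset_inter_right _ (ball_subset_ball hr.2.le)) le_rfl).trans hle

end MetricBV
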